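/- arXiv:1210.0017 — 3 statements merged into one kernel-verified Lean document; each statement's English description precedes it below -/
import Mathlib

section
/- There exists a universal constant C such that for every integer z ≥ 0, the L¹(ℝ) norm of the Hermite function h_z satisfies ∫_ℝ |h_z(u)| du ≤ C (1+z)^{1/4}. -/
open MeasureTheory Real

/-- The Hermite function `h_z`. For `z = 0` this formula reduces to
`π^{-1/2} e^{-u²/2}`, matching the convention in the paper. -/
noncomputable def hermiteFun (z : ℕ) (u : ℝ) : ℝ :=
  ((2 : ℝ) ^ z * (Nat.factorial z : ℝ)) ^ (-(1 : ℝ) / 2) * (-1 : ℝ) ^ z *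
    Real.pi ^ (-(1 : ℝ) / 2) * Real.exp (u ^ 2 / 2) *
    iteratedDeriv z (fun v : ℝ => Real.exp (-v ^ 2)) u

namespace HermAux
open Polynomial

/-- Physicists' Hermite polynomials. -/
noncomputable def H : ℕ → ℝ[X]
  | 0 => 1
  | n + 1 => 2 * X * H n - derivative (H n)

/-- Gaussian integral of a polynomial. -/
noncomputable def L (p : ℝ[X]) : ℝ := ∫ x : ℝ, p.eval x * Real.exp (-x ^ 2)

lemma integ (p : ℝ[X]) : Integrable (fun x : ℝ => p.eval x * Real.exp (-x ^ 2)) := by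
  induction p using Polynomial.induction_on' with
  | add p q hp hq =>
    simp only [eval_add, add_mul]
    exact hp.add hq
  | monomial n a =>
    have h := integrable_rpow_mul_exp_neg_mul_sq (b := 1) one_pos (s := (n : ℝ))
      (by have : (0 : ℝ) ≤ n := n.cast_nonneg
          linarith)
    have h2 := h.const_mul a
    refine h2.congr (Filter.Eventually.of_forall fun x => ?_)
    simp [eval_monomial, Real.rpow_natCast, mul_assoc]

lemma L_add (p q : ℝ[X]) : L (p + q) = L p + L q := by
  unfold L
  rw [← integral_add (integ p) (integ q)]
  simp [add_mul]

lemma L_smul (a : ℝ) (p : ℝ[X]) : L (C a * p) = a * L p := by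
  unfold L
  rw [← integral_const_mul]
  simp [mul_assoc]

lemma L_sub (p q : ℝ[X]) : L (p - q) = L p - L q := by
  unfold L
  rw [← integral_sub (integ p) (integ q)]
  simp [sub_mul]

lemma hasDeriv (p : ℝ[X]) (x : ℝ) : HasDerivAt (fun x : ℝ => p.eval x * Real.exp (-x ^ 2))
    ((derivative p - 2 * X * p).eval x * Real.exp (-x ^ 2)) x := by
  have h1 := p.hasDerivAt x
  have h2 : HasDerivAt (fun x : ℝ => Real.exp (-x ^ 2)) (Real.exp (-x ^ 2) * (-(2 * x))) x := by
    have := ((hasDerivAt_pow 2 x).neg).exp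
    simpa using this
  refine (h1.mul h2).congr_deriv ?_
  simp only [eval_sub, eval_mul, eval_X, eval_ofNat]
  ring

lemma L_parts (p : ℝ[X]) : L (derivative p) = L (2 * X * p) := by
  have h : ∫ x : ℝ, (derivative p - 2 * X * p).eval x * Real.exp (-x ^ 2) = 0 :=
    integral_eq_zero_of_hasDerivAt_of_integrable (hasDeriv p) (integ _) (integ _)
  have h2 : L (derivative p - 2 * X * p) = 0 := h
  rw [L_sub] at h2
  linarith

lemma dH (n : ℕ) : derivative (H (n + 1)) = C (2 * ((n : ℝ) + 1)) * H n := by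
  induction n with
  | zero => simp [H, map_ofNat]
  | succ n ih =>
    rw [H, derivative_sub, derivative_mul, ih]
    have : H (n + 1) = 2 * X * H n - derivative (H n) := rfl
    simp only [derivative_mul, derivative_X, derivative_C, derivative_ofNat]
    rw [this]
    simp only [map_mul, map_add, Nat.cast_add, Nat.cast_one, map_natCast, map_one, map_ofNat]
    ring

lemma L_shift (n : ℕ) (q : ℝ[X]) : L (H (n + 1) * q) = L (H n * derivative q) := by
  have h := L_parts (H n * q)
  rw [derivative_mul, L_add] at h
  have : H (n + 1) * q = 2 * X * (H n * q) - derivative (H n) * q := by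
    rw [H]; ring
  rw [this, L_sub]
  linarith

lemma D_succ (n : ℕ) : L (H (n + 1) ^ 2) = 2 * ((n : ℝ) + 1) * L (H n ^ 2) := by
  rw [pow_two, L_shift, dH, ← L_smul]
  congr 1; ring

lemma D_eq (n : ℕ) : L (H n ^ 2) = 2 ^ n * (Nat.factorial n : ℝ) * L 1 := by
  induction n with
  | zero => simp [H]
  | succ n ih =>
    rw [D_succ, ih, Nat.factorial_succ]
    push_cast
    ring

lemma dH_sq (n : ℕ) : L (derivative (H n) ^ 2) = 2 * (n : ℝ) * L (H n ^ 2) := by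
  cases n with
  | zero => simp [H, L]
  | succ n =>
    rw [dH, D_succ, mul_pow, ← C_pow, L_smul]
    push_cast
    ring

lemma L_nonneg (p : ℝ[X]) (h : ∀ x, 0 ≤ p.eval x) : 0 ≤ L p :=
  integral_nonneg fun x => mul_nonneg (h x) (Real.exp_pos _).le

lemma X_sq (n : ℕ) : L (X ^ 2 * H n ^ 2) ≤ (2 * (n : ℝ) + 1) * L (H n ^ 2) := by
  have h0 : 0 ≤ L (H (n + 1) ^ 2 + derivative (H n) ^ 2 - C 2 * (X ^ 2 * H n ^ 2)) := by
    apply L_nonneg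
    intro x
    rw [H]
    simp only [eval_sub, eval_add, eval_pow, eval_mul, eval_X, eval_C, eval_ofNat]
    nlinarith [sq_nonneg (2 * x * (H n).eval x - 2 * (derivative (H n)).eval x)]
  rw [L_sub, L_add, L_smul, dH_sq, D_succ] at h0
  linarith

lemma iter (n : ℕ) : iteratedDeriv n (fun v : ℝ => Real.exp (-v ^ 2)) =
    fun x => (-1) ^ n * ((H n).eval x * Real.exp (-x ^ 2)) := by
  induction n with
  | zero => simp [H]
  | succ n ih =>
    rw [iteratedDeriv_succ, ih]
    funext x
    rw [((hasDeriv (H n) x).const_mul _).deriv, H]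
    simp
    ring

lemma sq_eq (z : ℕ) (u : ℝ) : hermiteFun z u ^ 2 =
    ((2 : ℝ) ^ z * (Nat.factorial z : ℝ))⁻¹ * π⁻¹ * ((H z ^ 2).eval u * Real.exp (-u ^ 2)) := by
  have key : ∀ y : ℝ, 0 < y → (y ^ (-(1 : ℝ) / 2)) ^ 2 = y⁻¹ := by
    intro y hy
    rw [← Real.rpow_natCast, ← Real.rpow_mul hy.le]
    norm_num [Real.rpow_neg_one]
  have hf : (0 : ℝ) < 2 ^ z * (Nat.factorial z : ℝ) := by positivity
  have e : Real.exp (u ^ 2 / 2) ^ 2 * Real.exp (-u ^ 2) = 1 := by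
    rw [← Real.exp_nat_mul, ← Real.exp_add]
    simp
    ring
  have s : (((-1 : ℝ)) ^ z) ^ 2 = 1 := by rw [← pow_mul, mul_comm, pow_mul]; simp
  unfold hermiteFun
  rw [iter]
  simp only [mul_pow, eval_pow]
  rw [key _ hf, key _ pi_pos, s]
  linear_combination (((2 : ℝ) ^ z * (Nat.factorial z : ℝ))⁻¹ * π⁻¹ *
    ((H z).eval u ^ 2 * Real.exp (-u ^ 2))) * e

end HermAux

open HermAux Polynomial in
/-- There is a universal constant `C` such that the `L¹(ℝ)` norm of the Hermite
function `h_z` is at most `C (1+z)^{1/4}`. -/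
theorem stmt_0 :
    ∃ C : ℝ, ∀ z : ℕ,
      (∫ u : ℝ, |hermiteFun z u|) ≤ C * (1 + (z : ℝ)) ^ ((1 : ℝ) / 4) := by
  refine ⟨(3 * (π⁻¹ * L 1) + π) / 2, fun z => ?_⟩
  have hN : (0 : ℝ) < 1 + z := by positivity
  set a : ℝ := (1 + (z : ℝ)) ^ ((1 : ℝ) / 4) with ha
  have ha0 : 0 < a := Real.rpow_pos_of_pos hN _
  have ha4 : a ^ 4 = 1 + z := by
    rw [ha, ← Real.rpow_natCast, ← Real.rpow_mul hN.le]
    norm_num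
  set k : ℝ := ((2 : ℝ) ^ z * (Nat.factorial z : ℝ))⁻¹ * π⁻¹ with hk
  have hk0 : 0 ≤ k := by have := pi_pos; positivity
  have hkD : k * L (H z ^ 2) = π⁻¹ * L 1 := by
    rw [D_eq, hk]
    have : (Nat.factorial z : ℝ) ≠ 0 := by positivity
    field_simp
  -- integrable pieces
  set P : ℝ[X] := H z ^ 2 + C ((a ^ 4)⁻¹) * (X ^ 2 * H z ^ 2) with hP
  have hpt : ∀ u : ℝ, |hermiteFun z u| ≤
      (a * k / 2) * (P.eval u * Real.exp (-u ^ 2)) + (1 / (2 * a)) * (1 + (u / a ^ 2) ^ 2)⁻¹ := by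
    intro u
    have hw : 0 < 1 + (u / a ^ 2) ^ 2 := by positivity
    have e1 : (a * k / 2) * (P.eval u * Real.exp (-u ^ 2))
        = a / 2 * (1 + (u / a ^ 2) ^ 2) * |hermiteFun z u| ^ 2 := by
      rw [sq_abs, sq_eq, ← hk, hP]
      simp only [eval_add, eval_mul, eval_C, eval_pow, eval_X]
      field_simp
    rw [e1]
    set w := 1 + (u / a ^ 2) ^ 2
    set t := |hermiteFun z u|
    have : a / 2 * w * t ^ 2 + (1 / (2 * a)) * w⁻¹ - t = (a * w * t - 1) ^ 2 / (2 * a * w) := by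
      field_simp
      ring
    have h2 : 0 ≤ (a * w * t - 1) ^ 2 / (2 * a * w) := by positivity
    linarith
  have i1 : Integrable (fun u : ℝ => (a * k / 2) * (P.eval u * Real.exp (-u ^ 2))) :=
    (integ P).const_mul _
  have i2 : Integrable (fun u : ℝ => (1 / (2 * a)) * (1 + (u / a ^ 2) ^ 2)⁻¹) :=
    (integrable_inv_one_add_sq.comp_div (by positivity : a ^ 2 ≠ 0)).const_mul _
  have hI : (∫ u : ℝ, (1 + (u / a ^ 2) ^ 2)⁻¹) = a ^ 2 * π := by
    rw [Measure.integral_comp_div (fun x : ℝ => (1 + x ^ 2)⁻¹) (a ^ 2),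
      integral_univ_inv_one_add_sq, abs_of_pos (by positivity), smul_eq_mul]
  have hLP : k * L P ≤ 3 * (π⁻¹ * L 1) := by
    have h1 := X_sq z
    have hD : 0 ≤ L (H z ^ 2) := L_nonneg _ fun x => by rw [eval_pow]; positivity
    have h3 : L P ≤ 3 * L (H z ^ 2) := by
      rw [hP, L_add, L_smul, ha4]
      have h4 : (1 + (z : ℝ))⁻¹ * L (X ^ 2 * H z ^ 2) ≤ 2 * L (H z ^ 2) := by
        rw [inv_mul_le_iff₀ hN]
        nlinarith
      linarith
    calc k * L P ≤ k * (3 * L (H z ^ 2)) := mul_le_mul_of_nonneg_left h3 hk0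
      _ = 3 * (π⁻¹ * L 1) := by rw [← hkD]; ring
  calc (∫ u : ℝ, |hermiteFun z u|) ≤ ∫ u : ℝ, ((a * k / 2) * (P.eval u * Real.exp (-u ^ 2))
        + (1 / (2 * a)) * (1 + (u / a ^ 2) ^ 2)⁻¹) :=
        integral_mono_of_nonneg (Filter.Eventually.of_forall fun u => abs_nonneg _)
          (i1.add i2) (Filter.Eventually.of_forall hpt)
    _ = a / 2 * (k * L P) + a / 2 * π := by
        rw [integral_add i1 i2, integral_const_mul, integral_const_mul, hI]
        unfold L
        field_simp
    _ ≤ a / 2 * (3 * (π⁻¹ * L 1)) + a / 2 * π := by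
        gcongr
    _ = _ := by ring
end

section
/- Let ρ ∈ (0,1) and let κ : ℝ → ℝ be a bounded continuous function. For each n large enough that ρ + κ(x/n)/√n ∈ (0,1) for all x ∈ ℤ, let μⁿ be the product Bernoulli measure on {0,1}^ℤ with μⁿ(η(x)=1) = ρ + κ(x/n)/√n. Then for every continuous compactly supported G : ℝ → ℝ, the random variable Y₀ⁿ(G) = n^{-1/2} ∑_{x∈ℤ} G(x/n)(η(x) − ρ), with η distributed according to μⁿ, converges in distribution as n → ∞ to a Gaussian random variable with mean ∫_ℝ G(u)κ(u) du and variance ρ(1−ρ) ∫_ℝ G(u)² du. -/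
open MeasureTheory ENNReal Filter

open scoped Topology

/-- `μ` is the product Bernoulli measure on `{0,1}^ℤ` with success
probabilities `p x`, characterized by its cylinder probabilities. -/
def IsBernoulliProduct (μ : Measure (ℤ → Bool)) (p : ℤ → ℝ) : Prop :=
  ∀ (s : Finset ℤ) (f : ℤ → Bool),
    μ {η | ∀ x ∈ s, η x = f x} =
      ∏ x ∈ s, ENNReal.ofReal (if f x then p x else 1 - p x)


/-- The lattice points `x` with `-K n ≤ x < K n`. -/
def latticeWindow (K n : ℕ) : Finset ℤ :=
  (Finset.range (2 * K * n)).image (fun k : ℕ => (k : ℤ) - (K * n : ℕ))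

lemma latticeWindow_inj (K n : ℕ) :
    Function.Injective (fun k : ℕ => (k : ℤ) - (K * n : ℕ)) := by
  intro a b h
  simpa using h

lemma card_latticeWindow (K n : ℕ) : (latticeWindow K n).card = 2 * K * n := by
  rw [latticeWindow, Finset.card_image_of_injective _ (latticeWindow_inj K n), Finset.card_range]

lemma mem_latticeWindow (K n : ℕ) (x : ℤ) :
    x ∈ latticeWindow K n ↔ -((K * n : ℕ) : ℤ) ≤ x ∧ x < (K * n : ℕ) := by
  simp only [latticeWindow, Finset.mem_image, Finset.mem_range, mul_assoc]
  generalize K * n = m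
  constructor
  · rintro ⟨k, hk, rfl⟩
    omega
  · rintro ⟨h1, h2⟩
    exact ⟨(x + m).toNat, by omega, by omega⟩

/-- Riemann sums of a continuous compactly supported function. -/
lemma riemann_sum_tendsto (F : ℝ → ℝ) (hF : Continuous F) (hFs : HasCompactSupport F)
    (K : ℕ) (hK : ∀ u, (K : ℝ) ≤ |u| → F u = 0) :
    Tendsto (fun n : ℕ => ∑ x ∈ latticeWindow K n, F ((x : ℝ) / n) / n) atTop
      (𝓝 (∫ u, F u)) := by
  have hU : UniformContinuous F := hF.uniformContinuous_of_tendsto_cocompact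
    hFs.is_zero_at_infty
  have hint : ∫ u in (-(K : ℝ))..K, F u = ∫ u, F u := by
    apply intervalIntegral.integral_eq_integral_of_support_subset
    intro u hu
    have h1 : |u| < K := by
      by_contra h
      exact hu (hK u (not_lt.mp h))
    exact ⟨(abs_lt.mp h1).1, (abs_lt.mp h1).2.le⟩
  rw [Metric.tendsto_atTop]
  intro ε hε
  obtain ⟨δ, hδ, hUδ⟩ := Metric.uniformContinuous_iff.mp hU (ε / (2 * K + 1)) (by positivity)
  obtain ⟨N, hN⟩ := exists_nat_gt (1 / δ)
  refine ⟨N + 1, fun n hn => ?_⟩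
  have hn0 : (0 : ℝ) < n := by
    have : 0 < n := by omega
    exact_mod_cast this
  have hnδ : 1 / (n : ℝ) < δ := by
    have : (N : ℝ) + 1 ≤ n := by exact_mod_cast hn
    rw [div_lt_iff₀ hn0]
    rw [div_lt_iff₀ hδ] at hN
    nlinarith
  set a : ℕ → ℝ := fun k => ((k : ℝ) - K * n) / n with ha
  have hsum : ∫ u, F u = ∑ k ∈ Finset.range (2 * K * n), ∫ u in a k..a (k + 1), F u := by
    rw [intervalIntegral.sum_integral_adjacent_intervals
      (fun k _ => hF.intervalIntegrable _ _), ← hint]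
    congr 1
    · simp only [ha]; push_cast; field_simp; ring
    · simp only [ha]; push_cast; field_simp; ring
  have hstep : ∀ k, a (k + 1) - a k = 1 / n := by
    intro k
    simp only [ha]; push_cast; field_simp; ring
  have hwin : ∑ x ∈ latticeWindow K n, F ((x : ℝ) / n) / n =
      ∑ k ∈ Finset.range (2 * K * n), F (a k) / n := by
    rw [latticeWindow, Finset.sum_image ((latticeWindow_inj K n).injOn)]
    simp [ha]
  rw [hwin, hsum, dist_eq_norm, ← Finset.sum_sub_distrib]
  have hterm : ∀ k ∈ Finset.range (2 * K * n),
      ‖F (a k) / n - ∫ u in a k..a (k + 1), F u‖ ≤ ε / (2 * K + 1) * (1 / n) := by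
    intro k _
    have h1 : F (a k) / n - ∫ u in a k..a (k + 1), F u = ∫ u in a k..a (k + 1), (F (a k) - F u) := by
      rw [intervalIntegral.integral_sub (by simp) (hF.intervalIntegrable _ _)]
      simp [hstep k]
      ring
    rw [h1]
    have h2 := intervalIntegral.norm_integral_le_of_norm_le_const (a := a k) (b := a (k + 1))
      (f := fun u => F (a k) - F u) (C := ε / (2 * K + 1)) ?_
    · rwa [hstep k, abs_of_pos (by positivity)] at h2
    · intro u hu
      rw [Set.uIoc_of_le (by have := hstep k; have : 0 < 1 / (n : ℝ) := by positivity
                             linarith)] at hu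
      rw [← dist_eq_norm]
      apply le_of_lt
      apply hUδ
      rw [Real.dist_eq, abs_sub_comm, abs_of_pos (by linarith [hu.1])]
      linarith [hu.2, hstep k]
  refine lt_of_le_of_lt (norm_sum_le_of_le _ hterm) ?_
  simp only [Finset.sum_const, Finset.card_range, nsmul_eq_mul]
  push_cast
  have : 2 * (K : ℝ) * n * (ε / (2 * K + 1) * (1 / n)) = ε * (2 * K / (2 * K + 1)) := by
    field_simp
  rw [this]
  have h3 : 2 * (K : ℝ) / (2 * K + 1) < 1 := by
    rw [div_lt_one (by positivity)]; linarith
  nlinarith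

/-- Expectation of a product of functions of single coordinates. -/
lemma bernoulli_integral_prod (μ : Measure (ℤ → Bool)) [IsProbabilityMeasure μ] (p : ℤ → ℝ)
    (hp : ∀ x, p x ∈ Set.Ioo (0 : ℝ) 1) (hμ : IsBernoulliProduct μ p) (s : Finset ℤ)
    (g : ℤ → Bool → ℂ) :
    ∫ η, ∏ x ∈ s, g x (η x) ∂μ =
      ∏ x ∈ s, ((p x : ℂ) * g x true + (1 - (p x : ℂ)) * g x false) := by
  classical
  set C : Finset ℤ → Set (ℤ → Bool) := fun A => {η | ∀ x ∈ s, η x = decide (x ∈ A)} with hC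
  have hCm : ∀ A, MeasurableSet (C A) := by
    intro A
    have : C A = ⋂ x ∈ s, (fun η : ℤ → Bool => η x) ⁻¹' {decide (x ∈ A)} := by
      ext η; simp [hC]
    rw [this]
    exact Finset.measurableSet_biInter _
      (fun x _ => measurable_pi_apply x (measurableSet_singleton _))
  have hdec : ∀ η : ℤ → Bool, ∏ x ∈ s, g x (η x) =
      ∑ A ∈ s.powerset, (C A).indicator (fun _ => ∏ x ∈ s, g x (decide (x ∈ A))) η := by
    intro η
    rw [Finset.sum_eq_single (s.filter (fun x => η x = true))]
    · rw [Set.indicator_of_mem]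
      · apply Finset.prod_congr rfl
        intro x hx
        congr 1
        cases h : η x <;> simp [hx, h]
      · intro x hx
        cases h : η x <;> simp [hx, h]
    · intro A hA hne
      apply Set.indicator_of_notMem
      intro hη
      apply hne
      ext x
      simp only [Finset.mem_filter]
      constructor
      · intro hx
        have hxs := Finset.mem_powerset.mp hA hx
        exact ⟨hxs, by rw [hη x hxs]; simpa using hx⟩
      · rintro ⟨hxs, hx⟩
        rw [hη x hxs] at hx
        simpa using hx
    · intro h
      exact absurd (Finset.mem_powerset.mpr (Finset.filter_subset _ _)) h
  rw [integral_congr_ae (ae_of_all _ hdec)]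
  rw [integral_finsetSum _ (fun A _ => (integrable_const _).indicator (hCm A)), Finset.prod_add]
  apply Finset.sum_congr rfl
  intro A hA
  have hAs := Finset.mem_powerset.mp hA
  rw [integral_indicator_const _ (hCm A)]
  have hreal : μ.real (C A) = ∏ x ∈ s, (if x ∈ A then p x else 1 - p x) := by
    rw [Measure.real, hC]
    have := hμ s (fun x => decide (x ∈ A))
    simp only [decide_eq_true_eq] at this
    rw [this, ENNReal.toReal_prod]
    apply Finset.prod_congr rfl
    intro x _
    rw [ENNReal.toReal_ofReal]
    have := hp x
    split_ifs
    · exact this.1.le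
    · linarith [this.2]
  rw [hreal, Complex.real_smul]
  push_cast
  rw [← Finset.prod_mul_distrib, ← Finset.prod_sdiff hAs, mul_comm]
  congr 1
  · apply Finset.prod_congr rfl
    intro x hx
    simp [hx]
  · apply Finset.prod_congr rfl
    intro x hx
    simp [(Finset.mem_sdiff.mp hx).2]

lemma norm_prod_sub_prod_le_sum (s : Finset ℤ) (a b : ℤ → ℂ) (ha : ∀ x ∈ s, ‖a x‖ ≤ 1)
    (hb : ∀ x ∈ s, ‖b x‖ ≤ 1) :
    ‖∏ x ∈ s, a x - ∏ x ∈ s, b x‖ ≤ ∑ x ∈ s, ‖a x - b x‖ := by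
  classical
  induction s using Finset.induction_on with
  | empty => simp
  | insert y s hy ih =>
    rw [Finset.prod_insert hy, Finset.prod_insert hy, Finset.sum_insert hy]
    have ih' := ih (fun x hx => ha x (Finset.mem_insert_of_mem hx))
      (fun x hx => hb x (Finset.mem_insert_of_mem hx))
    have hbp : ‖∏ x ∈ s, b x‖ ≤ 1 := by
      rw [norm_prod]
      exact Finset.prod_le_one (fun _ _ => norm_nonneg _)
        (fun x hx => hb x (Finset.mem_insert_of_mem hx))
    have hay := ha y (Finset.mem_insert_self _ _)
    have : a y * ∏ x ∈ s, a x - b y * ∏ x ∈ s, b x =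
        (a y - b y) * ∏ x ∈ s, b x + a y * (∏ x ∈ s, a x - ∏ x ∈ s, b x) := by ring
    rw [this]
    refine (norm_add_le _ _).trans ?_
    rw [norm_mul, norm_mul]
    have h1 := mul_le_mul_of_nonneg_left hbp (norm_nonneg (a y - b y))
    have h2 := mul_le_mul_of_nonneg_right hay (norm_nonneg (∏ x ∈ s, a x - ∏ x ∈ s, b x))
    linarith

lemma exp_taylor_two (w : ℂ) (hw : ‖w‖ ≤ 1) :
    ‖Complex.exp w - 1 - w - w ^ 2 / 2‖ ≤ ‖w‖ ^ 3 := by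
  have h := Complex.exp_bound hw (n := 3) (by norm_num)
  simp only [Finset.sum_range_succ, Finset.sum_range_zero] at h
  norm_num [Nat.factorial] at h
  have e : Complex.exp w - 1 - w - w ^ 2 / 2 = Complex.exp w - (1 + w + w ^ 2 / 2) := by ring
  rw [e]
  refine h.trans ?_
  have : 0 ≤ ‖w‖ ^ 3 := by positivity
  linarith

/-- One-site estimate. -/
lemma one_site (ρ t B M : ℝ) (hρ : ρ ∈ Set.Ioo (0 : ℝ) 1) (hB : 0 ≤ B) (hM : 0 ≤ M)
    (h g k : ℝ) (hh : 0 ≤ h) (hh1 : h ≤ 1) (hg : |g| ≤ B) (hk : |k| ≤ M)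
    (hp : ρ + k * h ∈ Set.Ioo (0 : ℝ) 1) (hz : |t| * B * h ≤ 1)
    (hc : (|t| * M * B + t ^ 2 * B ^ 2) * h ^ 2 ≤ 1) :
    ‖(((ρ + k * h : ℝ) : ℂ) * Complex.exp (t * (h * (g * (1 - ρ))) * Complex.I) +
        (1 - ((ρ + k * h : ℝ) : ℂ)) * Complex.exp (t * (h * (g * (0 - ρ))) * Complex.I)) -
      Complex.exp (h ^ 2 * (t * (g * k) * Complex.I - ρ * (1 - ρ) * g ^ 2 * t ^ 2 / 2))‖ ≤
    ((|t| * B) ^ 3 + (|t| * B) ^ 2 * M + (|t| * M * B + t ^ 2 * B ^ 2) ^ 2) * h ^ 3 := by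
  obtain ⟨hρ0, hρ1⟩ := hρ
  obtain ⟨hp0, hp1⟩ := hp
  set p : ℝ := ρ + k * h with hpdef
  set D : ℝ := |t| * M * B + t ^ 2 * B ^ 2 with hD
  have hD0 : 0 ≤ D := by positivity
  set z : ℂ := t * h * g * Complex.I with hzdef
  have hzn : ‖z‖ ≤ |t| * B * h := by
    simp only [hzdef, norm_mul, Complex.norm_real, Complex.norm_I, mul_one, Real.norm_eq_abs]
    rw [abs_of_nonneg hh]
    have := mul_le_mul_of_nonneg_left hg (mul_nonneg (abs_nonneg t) hh)
    linarith
  have hz1 : ‖z‖ ≤ 1 := hzn.trans hz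
  set w1 : ℂ := z * (1 - ρ) with hw1
  set w0 : ℂ := z * (0 - ρ) with hw0
  have e1 : (t * (h * (g * (1 - ρ))) * Complex.I : ℂ) = w1 := by rw [hw1, hzdef]; ring
  have e0 : (t * (h * (g * (0 - ρ))) * Complex.I : ℂ) = w0 := by rw [hw0, hzdef]; ring
  have hn1 : ‖w1‖ ≤ ‖z‖ := by
    rw [hw1, norm_mul]
    have : ‖(1 - ρ : ℂ)‖ = 1 - ρ := by
      rw [← Complex.ofReal_one, ← Complex.ofReal_sub, Complex.norm_real, Real.norm_eq_abs,
        abs_of_pos (by linarith)]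
    rw [this]
    nlinarith [norm_nonneg z]
  have hn0 : ‖w0‖ ≤ ‖z‖ := by
    rw [hw0, norm_mul]
    have : ‖(0 - ρ : ℂ)‖ = ρ := by
      rw [zero_sub, norm_neg, Complex.norm_real, Real.norm_eq_abs, abs_of_pos hρ0]
    rw [this]
    nlinarith [norm_nonneg z]
  rw [e1, e0]
  have t1 := exp_taylor_two w1 (hn1.trans hz1)
  have t0 := exp_taylor_two w0 (hn0.trans hz1)
  set c : ℂ := h ^ 2 * (t * (g * k) * Complex.I - ρ * (1 - ρ) * g ^ 2 * t ^ 2 / 2) with hcdef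
  have hcn : ‖c‖ ≤ D * h ^ 2 := by
    rw [hcdef, norm_mul]
    have a1 : ‖(h ^ 2 : ℂ)‖ = h ^ 2 := by
      rw [norm_pow, Complex.norm_real, Real.norm_eq_abs, sq_abs]
    have a2 : ‖(t * (g * k) * Complex.I : ℂ)‖ ≤ |t| * M * B := by
      simp only [norm_mul, Complex.norm_real, Complex.norm_I, mul_one, Real.norm_eq_abs]
      have : |g| * |k| ≤ B * M := mul_le_mul hg hk (abs_nonneg _) hB
      nlinarith [abs_nonneg t]
    have a3 : ‖(ρ * (1 - ρ) * g ^ 2 * t ^ 2 / 2 : ℂ)‖ ≤ t ^ 2 * B ^ 2 := by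
      have : (ρ * (1 - ρ) * g ^ 2 * t ^ 2 / 2 : ℂ) =
        ((ρ * (1 - ρ) * g ^ 2 * t ^ 2 / 2 : ℝ) : ℂ) := by push_cast; ring
      rw [this, Complex.norm_real, Real.norm_eq_abs]
      have q1 : 0 ≤ ρ * (1 - ρ) := mul_nonneg hρ0.le (by linarith)
      have q2 : ρ * (1 - ρ) ≤ 1 := by nlinarith
      have q3 : g ^ 2 ≤ B ^ 2 := sq_le_sq' (by linarith [neg_abs_le g]) (by linarith [le_abs_self g])
      rw [abs_of_nonneg (by positivity)]
      have q4 : g ^ 2 * t ^ 2 ≤ B ^ 2 * t ^ 2 := mul_le_mul_of_nonneg_right q3 (sq_nonneg t)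
      have q5 : ρ * (1 - ρ) * (g ^ 2 * t ^ 2) ≤ 1 * (g ^ 2 * t ^ 2) :=
        mul_le_mul_of_nonneg_right q2 (by positivity)
      have q6 : 0 ≤ ρ * (1 - ρ) * (g ^ 2 * t ^ 2) := by positivity
      nlinarith
    rw [a1, mul_comm]
    apply mul_le_mul_of_nonneg_right _ (sq_nonneg h)
    exact (norm_sub_le _ _).trans (add_le_add a2 a3)
  have tc := Complex.norm_exp_sub_one_sub_id_le (hcn.trans hc)
  have key : ((p : ℂ) * Complex.exp w1 + (1 - (p : ℂ)) * Complex.exp w0) - Complex.exp c =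
      (p : ℂ) * (Complex.exp w1 - 1 - w1 - w1 ^ 2 / 2) +
      ((1 - p : ℝ) : ℂ) * (Complex.exp w0 - 1 - w0 - w0 ^ 2 / 2) +
      z ^ 2 * ((k * h * (1 - 2 * ρ) / 2 : ℝ) : ℂ) - (Complex.exp c - 1 - c) := by
    rw [hw1, hw0, hcdef, hzdef, hpdef]
    push_cast
    ring_nf
    simp only [Complex.I_sq]
    ring
  rw [key]
  have b1 : ‖(p : ℂ) * (Complex.exp w1 - 1 - w1 - w1 ^ 2 / 2)‖ ≤ p * (|t| * B * h) ^ 3 := by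
    rw [norm_mul, Complex.norm_real, Real.norm_eq_abs, abs_of_pos hp0]
    apply mul_le_mul_of_nonneg_left _ hp0.le
    exact t1.trans (pow_le_pow_left₀ (norm_nonneg _) (hn1.trans hzn) 3)
  have b0 : ‖((1 - p : ℝ) : ℂ) * (Complex.exp w0 - 1 - w0 - w0 ^ 2 / 2)‖ ≤
      (1 - p) * (|t| * B * h) ^ 3 := by
    rw [norm_mul, Complex.norm_real, Real.norm_eq_abs, abs_of_pos (by linarith)]
    apply mul_le_mul_of_nonneg_left _ (by linarith)
    exact t0.trans (pow_le_pow_left₀ (norm_nonneg _) (hn0.trans hzn) 3)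
  have b2 : ‖z ^ 2 * ((k * h * (1 - 2 * ρ) / 2 : ℝ) : ℂ)‖ ≤ (|t| * B * h) ^ 2 * (M * h) := by
    rw [norm_mul, norm_pow, Complex.norm_real, Real.norm_eq_abs]
    apply mul_le_mul (pow_le_pow_left₀ (norm_nonneg _) hzn 2) _ (abs_nonneg _) (by positivity)
    rw [abs_div, abs_mul, abs_mul, abs_of_nonneg hh]
    have r1 : |1 - 2 * ρ| ≤ 1 := by rw [abs_le]; constructor <;> linarith
    have r2 : |k| * h ≤ M * h := mul_le_mul_of_nonneg_right hk hh
    have r3 : |k| * h * |1 - 2 * ρ| ≤ M * h * 1 :=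
      mul_le_mul r2 r1 (abs_nonneg _) (by positivity)
    rw [abs_of_pos (by norm_num : (0 : ℝ) < 2)]
    have : 0 ≤ M * h := by positivity
    linarith
  have b3 : ‖Complex.exp c - 1 - c‖ ≤ D ^ 2 * h ^ 3 := by
    refine tc.trans ((pow_le_pow_left₀ (norm_nonneg _) hcn 2).trans ?_)
    have : h ^ 4 ≤ h ^ 3 := pow_le_pow_of_le_one hh hh1 (by norm_num)
    calc (D * h ^ 2) ^ 2 = D ^ 2 * h ^ 4 := by ring
      _ ≤ _ := mul_le_mul_of_nonneg_left this (sq_nonneg D)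
  refine (norm_sub_le _ _).trans ?_
  refine (add_le_add ((norm_add_le _ _).trans (add_le_add ((norm_add_le _ _).trans
    (add_le_add b1 b0)) b2)) b3).trans (le_of_eq ?_)
  ring

/-- The field as a finite sum. -/
lemma field_eq (G : ℝ → ℝ) (K : ℕ) (hK : ∀ u, (K : ℝ) ≤ |u| → G u = 0) (n : ℕ) (hn : 0 < n)
    (ρ : ℝ) (η : ℤ → Bool) :
    (n : ℝ) ^ (-(1 : ℝ) / 2) *
            ∑' x : ℤ, G ((x : ℝ) / n) * ((if η x then (1 : ℝ) else 0) - ρ) =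
    ∑ x ∈ latticeWindow K n,
      (√(n : ℝ))⁻¹ * (G ((x : ℝ) / n) * ((if η x then (1 : ℝ) else 0) - ρ)) := by
  have hn0 : (0 : ℝ) < n := by exact_mod_cast hn
  have h1 : (n : ℝ) ^ (-(1 : ℝ) / 2) = (√(n : ℝ))⁻¹ := by
    rw [neg_div, Real.rpow_neg hn0.le, Real.sqrt_eq_rpow]
  rw [h1, tsum_eq_sum (s := latticeWindow K n), Finset.mul_sum]
  intro x hx
  rw [hK, zero_mul]
  rw [mem_latticeWindow] at hx
  rw [abs_div, abs_of_pos hn0, le_div_iff₀ hn0]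
  have : ((K * n : ℕ) : ℤ) ≤ |x| := by
    rw [le_abs]
    omega
  exact_mod_cast this

/-- Measurability of the finite sum. -/
lemma field_measurable (s : Finset ℤ) (c : ℝ) (a : ℤ → ℝ) (ρ : ℝ) :
    Measurable (fun η : ℤ → Bool =>
      ∑ x ∈ s, c * (a x * ((if η x then (1 : ℝ) else 0) - ρ))) := by
  refine Finset.measurable_fun_sum _ (fun x _ => ?_)
  have : Measurable (fun b : Bool => c * (a x * ((if b then (1 : ℝ) else 0) - ρ))) :=
    measurable_from_top
  exact this.comp (measurable_pi_apply x)

/-- Convergence of the products of one-site characteristic functions. -/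
lemma prod_tendsto (ρ : ℝ) (hρ : ρ ∈ Set.Ioo (0 : ℝ) 1)
    (κ : ℝ → ℝ) (hκc : Continuous κ) (M : ℝ) (hκb : ∀ u, |κ u| ≤ M)
    (G : ℝ → ℝ) (hGc : Continuous G) (hGs : HasCompactSupport G)
    (K : ℕ) (hK : ∀ u, (K : ℝ) ≤ |u| → G u = 0)
    (hgood : ∀ᶠ n : ℕ in atTop, ∀ x : ℤ,
      ρ + κ ((x : ℝ) / n) / Real.sqrt n ∈ Set.Ioo (0 : ℝ) 1) (t : ℝ) :
    Tendsto (fun n : ℕ => ∏ x ∈ latticeWindow K n,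
      (((ρ + κ ((x : ℝ) / n) / Real.sqrt n : ℝ) : ℂ) *
          Complex.exp (t * ((√(n : ℝ))⁻¹ * (G ((x : ℝ) / n) * (1 - ρ)) : ℝ) * Complex.I) +
        (1 - ((ρ + κ ((x : ℝ) / n) / Real.sqrt n : ℝ) : ℂ)) *
          Complex.exp (t * ((√(n : ℝ))⁻¹ * (G ((x : ℝ) / n) * (0 - ρ)) : ℝ) * Complex.I)))
      atTop
      (𝓝 (Complex.exp (t * (∫ u, G u * κ u : ℝ) * Complex.I -
        (ρ * (1 - ρ) * ∫ u, G u ^ 2 : ℝ) * t ^ 2 / 2))) := by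
  obtain ⟨B, hB⟩ := hGs.exists_bound_of_continuous hGc
  have hB0 : 0 ≤ B := (norm_nonneg _).trans (hB 0)
  have hM0 : 0 ≤ M := (abs_nonneg _).trans (hκb 0)
  -- the comparison exponentials
  have hR1 := riemann_sum_tendsto (fun u => G u * κ u) (hGc.mul hκc) hGs.mul_right K
    (fun u hu => by simp [hK u hu])
  have hR2 := riemann_sum_tendsto (fun u => G u ^ 2) (hGc.pow 2)
    (hGs.comp_left (g := fun y : ℝ => y ^ 2) (by simp)) K (fun u hu => by simp [hK u hu])
  set c : ℕ → ℤ → ℂ := fun n x => ((√(n : ℝ))⁻¹ : ℝ) ^ 2 *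
    (t * (G ((x : ℝ) / n) * κ ((x : ℝ) / n)) * Complex.I -
      ρ * (1 - ρ) * G ((x : ℝ) / n) ^ 2 * t ^ 2 / 2) with hc
  have hexp : Tendsto (fun n : ℕ => ∏ x ∈ latticeWindow K n, Complex.exp (c n x)) atTop
      (𝓝 (Complex.exp (t * (∫ u, G u * κ u : ℝ) * Complex.I -
        (ρ * (1 - ρ) * ∫ u, G u ^ 2 : ℝ) * t ^ 2 / 2))) := by
    simp_rw [← Complex.exp_sum]
    apply (Complex.continuous_exp.tendsto _).comp
    have h1 : Tendsto (fun n : ℕ =>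
        (t : ℂ) * ((∑ x ∈ latticeWindow K n,
            G ((x : ℝ) / n) * κ ((x : ℝ) / n) / n : ℝ) : ℂ) * Complex.I -
          ((ρ * (1 - ρ) * ∑ x ∈ latticeWindow K n, G ((x : ℝ) / n) ^ 2 / n : ℝ) : ℂ) *
            (t : ℂ) ^ 2 / 2) atTop
        (𝓝 (t * (∫ u, G u * κ u : ℝ) * Complex.I -
        (ρ * (1 - ρ) * ∫ u, G u ^ 2 : ℝ) * t ^ 2 / 2)) := by
      refine Tendsto.sub ?_ ?_
      · exact (((Complex.continuous_ofReal.tendsto _).comp hR1).const_mul _).mul_const _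
      · exact (((Complex.continuous_ofReal.tendsto _).comp
          (hR2.const_mul (ρ * (1 - ρ)))).mul_const _).div_const _
    refine h1.congr (fun n => ?_)
    push_cast
    simp only [Finset.mul_sum, Finset.sum_mul, Finset.sum_div]
    rw [← Finset.sum_sub_distrib]
    apply Finset.sum_congr rfl
    intro x _
    have hs : (((√(n : ℝ))⁻¹ : ℝ) : ℂ) ^ 2 = (n : ℂ)⁻¹ := by
      rw [← Complex.ofReal_pow, inv_pow, Real.sq_sqrt (Nat.cast_nonneg n)]
      simp
    simp only [hc]
    rw [hs]
    ring
  -- small parameter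
  have hh : Tendsto (fun n : ℕ => (√(n : ℝ))⁻¹) atTop (𝓝 0) :=
    tendsto_inv_atTop_zero.comp (Real.tendsto_sqrt_atTop.comp tendsto_natCast_atTop_atTop)
  set D : ℝ := |t| * M * B + t ^ 2 * B ^ 2 with hD
  set E : ℝ := (|t| * B) ^ 3 + (|t| * B) ^ 2 * M + D ^ 2 with hE
  have ev1 : ∀ᶠ n : ℕ in atTop, (√(n : ℝ))⁻¹ ≤ 1 := hh.eventually_le_const (by norm_num)
  have ev2 : ∀ᶠ n : ℕ in atTop, |t| * B * (√(n : ℝ))⁻¹ ≤ 1 := by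
    have := hh.const_mul (|t| * B)
    exact this.eventually_le_const (by norm_num)
  have ev3 : ∀ᶠ n : ℕ in atTop, D * (√(n : ℝ))⁻¹ ^ 2 ≤ 1 := by
    have := (hh.pow 2).const_mul D
    exact this.eventually_le_const (by norm_num)
  refine (tendsto_iff_of_dist (f₁ := fun n : ℕ => ∏ x ∈ latticeWindow K n, Complex.exp (c n x))
    ?_).mp hexp
  have hlim : Tendsto (fun n : ℕ => 2 * K * E * (√(n : ℝ))⁻¹) atTop (𝓝 0) := by
    simpa using hh.const_mul (2 * K * E)
  refine squeeze_zero' (Eventually.of_forall fun _ => dist_nonneg) ?_ hlim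
  filter_upwards [ev1, ev2, ev3, hgood, eventually_gt_atTop 0] with n h1 h2 h3 h4 h5
  have hn0 : (0 : ℝ) < n := by exact_mod_cast h5
  have hs0 : 0 < √(n : ℝ) := Real.sqrt_pos.mpr hn0
  rw [dist_comm, dist_eq_norm]
  refine (norm_prod_sub_prod_le_sum _ _ _ ?_ ?_).trans ?_
  · intro x _
    obtain ⟨hp0, hp1⟩ := h4 x
    refine (norm_add_le _ _).trans ?_
    rw [norm_mul, norm_mul, ← Complex.ofReal_mul, ← Complex.ofReal_mul,
      Complex.norm_exp_ofReal_mul_I, Complex.norm_exp_ofReal_mul_I, ← Complex.ofReal_one,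
      ← Complex.ofReal_sub, Complex.norm_real, Complex.norm_real, Real.norm_eq_abs,
      Real.norm_eq_abs, abs_of_pos hp0, abs_of_pos (by linarith)]
    linarith
  · intro x _
    rw [Complex.norm_exp, Real.exp_le_one_iff]
    have : (c n x).re = -((√(n : ℝ))⁻¹ ^ 2 *
        (ρ * (1 - ρ) * G ((x : ℝ) / n) ^ 2 * t ^ 2 / 2)) := by
      have e : c n x = ((-((√(n : ℝ))⁻¹ ^ 2 *
        (ρ * (1 - ρ) * G ((x : ℝ) / n) ^ 2 * t ^ 2 / 2)) : ℝ) : ℂ) +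
        (((√(n : ℝ))⁻¹ ^ 2 * (t * (G ((x : ℝ) / n) * κ ((x : ℝ) / n))) : ℝ) : ℂ) *
          Complex.I := by
        simp only [hc]
        push_cast
        ring
      rw [e, Complex.add_re, Complex.ofReal_re, Complex.re_ofReal_mul, Complex.I_re]
      ring
    rw [this]
    have q : 0 ≤ 1 - ρ := by linarith [hρ.2]
    have q' : 0 ≤ ρ := hρ.1.le
    have : 0 ≤ (√(n : ℝ))⁻¹ ^ 2 * (ρ * (1 - ρ) * G ((x : ℝ) / n) ^ 2 * t ^ 2 / 2) := by
      positivity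
    linarith
  · have hterm : ∀ x ∈ latticeWindow K n,
      ‖(((ρ + κ ((x : ℝ) / n) / Real.sqrt n : ℝ) : ℂ) *
          Complex.exp (t * ((√(n : ℝ))⁻¹ * (G ((x : ℝ) / n) * (1 - ρ)) : ℝ) * Complex.I) +
        (1 - ((ρ + κ ((x : ℝ) / n) / Real.sqrt n : ℝ) : ℂ)) *
          Complex.exp (t * ((√(n : ℝ))⁻¹ * (G ((x : ℝ) / n) * (0 - ρ)) : ℝ) * Complex.I)) -
        Complex.exp (c n x)‖ ≤ E * (√(n : ℝ))⁻¹ ^ 3 := by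
      intro x _
      have := one_site ρ t B M hρ hB0 hM0 (√(n : ℝ))⁻¹ (G ((x : ℝ) / n)) (κ ((x : ℝ) / n))
        (by positivity) h1 (hB _) (hκb _) (by rw [← div_eq_mul_inv]; exact h4 x) h2 h3
      rw [← div_eq_mul_inv] at this
      refine le_trans (le_of_eq ?_) this
      simp only [hc]
      push_cast
      rfl
    refine (Finset.sum_le_sum hterm).trans (le_of_eq ?_)
    rw [Finset.sum_const, card_latticeWindow, nsmul_eq_mul]
    push_cast
    have : (n : ℝ) * (√(n : ℝ))⁻¹ ^ 2 = 1 := by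
      rw [inv_pow, Real.sq_sqrt hn0.le]
      field_simp
    linear_combination (2 * K * E * (√(n : ℝ))⁻¹) * this

/-- Central limit theorem for the initial density fluctuation field: starting
from the slowly varying product Bernoulli measures `μⁿ` with marginals
`ρ + κ(x/n)/√n`, the field `Y₀ⁿ(G) = n^{-1/2} ∑_x G(x/n)(η(x) − ρ)` converges
in distribution to a Gaussian with mean `∫ G κ` and variance
`ρ(1−ρ) ∫ G²`. -/
theorem stmt_7 (ρ : ℝ) (hρ : ρ ∈ Set.Ioo (0 : ℝ) 1)
    (κ : ℝ → ℝ) (hκc : Continuous κ) (M : ℝ) (hκb : ∀ u, |κ u| ≤ M)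
    (μ : ℕ → Measure (ℤ → Bool))
    (hμ : ∀ n : ℕ,
      (∀ x : ℤ, ρ + κ ((x : ℝ) / n) / Real.sqrt n ∈ Set.Ioo (0 : ℝ) 1) →
      IsBernoulliProduct (μ n) (fun x => ρ + κ ((x : ℝ) / n) / Real.sqrt n))
    (G : ℝ → ℝ) (hGc : Continuous G) (hGs : HasCompactSupport G) :
    ∀ f : BoundedContinuousFunction ℝ ℝ,
      Tendsto
        (fun n : ℕ => ∫ η, f ((n : ℝ) ^ (-(1 : ℝ) / 2) *
            ∑' x : ℤ, G ((x : ℝ) / n) * ((if η x then (1 : ℝ) else 0) - ρ)) ∂(μ n))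
        atTop
        (𝓝 (∫ y, f y ∂(ProbabilityTheory.gaussianReal
          (∫ u, G u * κ u)
          (Real.toNNReal (ρ * (1 - ρ) * ∫ u, G u ^ 2))))) := by
  -- support window
  obtain ⟨K, hK⟩ : ∃ K : ℕ, ∀ u, (K : ℝ) ≤ |u| → G u = 0 := by
    obtain ⟨R, hR⟩ := hGs.isCompact.isBounded.subset_ball (0 : ℝ)
    obtain ⟨K, hKR⟩ := exists_nat_ge R
    refine ⟨K, fun u hu => ?_⟩
    by_contra h
    have := hR (subset_tsupport G h)
    rw [mem_ball_zero_iff, Real.norm_eq_abs] at this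
    linarith
  have hh : Tendsto (fun n : ℕ => (√(n : ℝ))⁻¹) atTop (𝓝 0) :=
    tendsto_inv_atTop_zero.comp (Real.tendsto_sqrt_atTop.comp tendsto_natCast_atTop_atTop)
  have hgood : ∀ᶠ n : ℕ in atTop, ∀ x : ℤ,
      ρ + κ ((x : ℝ) / n) / Real.sqrt n ∈ Set.Ioo (0 : ℝ) 1 := by
    have h1 : Tendsto (fun n : ℕ => M * (√(n : ℝ))⁻¹) atTop (𝓝 0) := by
      simpa using hh.const_mul M
    filter_upwards [h1.eventually_lt_const hρ.1,
      h1.eventually_lt_const (show (0 : ℝ) < 1 - ρ by linarith [hρ.2])] with n ha hb x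
    have hi : 0 ≤ (√(n : ℝ))⁻¹ := by positivity
    have hk := abs_le.mp (hκb ((x : ℝ) / n))
    rw [div_eq_mul_inv]
    constructor
    · nlinarith [mul_le_mul_of_nonneg_right hk.1 hi]
    · nlinarith [mul_le_mul_of_nonneg_right hk.2 hi]
  obtain ⟨N, hN⟩ := eventually_atTop.mp (hgood.and (eventually_gt_atTop 0))
  have hprob : ∀ n, IsProbabilityMeasure (μ (n + N)) := by
    intro n
    refine ⟨?_⟩
    have := hμ (n + N) (hN _ (by omega)).1 ∅ (fun _ => true)
    simpa using this
  set Y : ℕ → (ℤ → Bool) → ℝ := fun n η => ∑ x ∈ latticeWindow K n,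
      (√(n : ℝ))⁻¹ * (G ((x : ℝ) / n) * ((if η x then (1 : ℝ) else 0) - ρ)) with hY
  have hYm : ∀ n, Measurable (Y n) := fun n => field_measurable _ _ _ _
  set ν : ℕ → ProbabilityMeasure ℝ := fun n =>
    ⟨(μ (n + N)).map (Y (n + N)),
      Measure.isProbabilityMeasure_map (hYm _).aemeasurable⟩ with hν
  set ν₀ : ProbabilityMeasure ℝ := ⟨ProbabilityTheory.gaussianReal
          (∫ u, G u * κ u) (Real.toNNReal (ρ * (1 - ρ) * ∫ u, G u ^ 2)), inferInstance⟩ with hν₀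
  have hconv : Tendsto ν atTop (𝓝 ν₀) := by
    apply ProbabilityMeasure.tendsto_of_tendsto_charFun
    intro t
    have hlim := (tendsto_add_atTop_iff_nat N).mpr
      (prod_tendsto ρ hρ κ hκc M hκb G hGc hGs K hK hgood t)
    have hv : 0 ≤ ρ * (1 - ρ) * ∫ u, G u ^ 2 :=
      mul_nonneg (mul_nonneg hρ.1.le (by linarith [hρ.2])) (integral_nonneg fun u => sq_nonneg _)
    have hg : charFun (ν₀ : Measure ℝ) t = Complex.exp (t * (∫ u, G u * κ u : ℝ) * Complex.I -
        (ρ * (1 - ρ) * ∫ u, G u ^ 2 : ℝ) * t ^ 2 / 2) := by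
      simp only [hν₀, ProbabilityMeasure.coe_mk]
      rw [ProbabilityTheory.charFun_gaussianReal, Real.coe_toNNReal _ hv]
    rw [hg]
    refine hlim.congr (fun n => ?_)
    have hgn := (hN (n + N) (by omega)).1
    haveI := hprob n
    simp only [hν, ProbabilityMeasure.coe_mk]
    rw [charFun_apply_real, integral_map (hYm _).aemeasurable
      (Continuous.aestronglyMeasurable (by fun_prop))]
    have hb := bernoulli_integral_prod (μ (n + N)) _ hgn (hμ _ hgn) (latticeWindow K (n + N))
      (fun x b => Complex.exp (t * ((√((n + N : ℕ) : ℝ))⁻¹ *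
        (G ((x : ℝ) / (n + N : ℕ)) * ((if b then (1 : ℝ) else 0) - ρ)) : ℝ) * Complex.I))
    simp only [if_true, Bool.false_eq_true, if_false] at hb
    rw [← hb]
    congr 1
    ext η
    rw [← Complex.exp_sum]
    congr 1
    simp only [hY, Complex.ofReal_sum, Finset.mul_sum, Finset.sum_mul]
  intro f
  have hfin := (ProbabilityMeasure.tendsto_iff_forall_integral_tendsto.mp hconv) f
  rw [← tendsto_add_atTop_iff_nat N]
  refine hfin.congr (fun n => ?_)
  simp only [hν, ProbabilityMeasure.coe_mk]
  rw [integral_map (hYm _).aemeasurable f.continuous.aestronglyMeasurable]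
  congr 1
  ext η
  rw [field_eq G K hK (n + N) (hN _ (by omega)).2 ρ η]
end

section
/- Let μ be a probability measure on ℕ with mean ρ and variance σ²(ρ) > 0 such that E_μ[e^{λ X}] < ∞ for |λ| ≤ λ* for some λ* > 0, and let ℓ ≥ 1. For admissible λ define the tilted measure dμ_λ ∝ e^{λ k} dμ, let λ(z) be the tilt for which the tilted mean equals z, and let ν_z = μ_{λ(z)}^{⊗ℓ}. Let h : ℕ^ℓ → ℝ be bounded and set g(y) = E_{ν_{ρ+y}}[h]. Then g is three times differentiable on a neighborhood of 0, and its third derivative is g'''(y) = λ'''(ρ+y) E[h̄ Σ] + 3 λ'(ρ+y) λ''(ρ+y) E[h̄ Σ²] + (λ'(ρ+y))³ E[h̄ Σ³] − 3 (λ'(ρ+y))³ E[h̄ Σ] E[Σ²], where h̄ = h − E_{ν_{ρ+y}}[h], Σ = ∑_{x=1}^ℓ (X_x − ρ − y), and all expectations are with respect to ν_{ρ+y}. -/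
open MeasureTheory

/-- The `ℓ`-fold product `ν_z = μ_{λ(z)}^{⊗ℓ}` of the exponentially tilted
measure `dμ_λ ∝ e^{λ k} dμ` with tilt `λ(z) = lam z`. -/
noncomputable def nuTilt (μ : Measure ℕ) [SigmaFinite μ] (lam : ℝ → ℝ) (ℓ : ℕ) (z : ℝ) :
    Measure (Fin ℓ → ℕ) :=
  haveI : SigmaFinite (μ.tilted fun k : ℕ => lam z * (k : ℝ)) := by
    unfold Measure.tilted; infer_instance
  Measure.pi fun _ : Fin ℓ => μ.tilted fun k : ℕ => lam z * (k : ℝ)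

/-- The tilted mean `g(y) = E_{ν_{ρ+y}}[h]`. -/
noncomputable def gFun (μ : Measure ℕ) [SigmaFinite μ] (lam : ℝ → ℝ) (ℓ : ℕ) (ρ : ℝ)
    (h : (Fin ℓ → ℕ) → ℝ) (y : ℝ) : ℝ :=
  ∫ ω, h ω ∂(nuTilt μ lam ℓ (ρ + y))

/-- The centered sum `Σ(ω) = ∑_{x=1}^ℓ (X_x − c)`. -/
def centSum (ℓ : ℕ) (c : ℝ) (ω : Fin ℓ → ℕ) : ℝ := ∑ i : Fin ℓ, ((ω i : ℝ) - c)


open ProbabilityTheory Filter Topology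

lemma aux_inj_lt (μ : Measure ℕ) [IsProbabilityMeasure μ] (hnc : ∀ m : ℝ, ¬ ∀ᵐ k : ℕ ∂μ, (k : ℝ) = m)
    (s t m : ℝ) (hst : s < t)
    (is : Integrable (fun k : ℕ => ((k : ℝ) - m) * Real.exp (s * k)) μ)
    (it : Integrable (fun k : ℕ => ((k : ℝ) - m) * Real.exp (t * k)) μ)
    (hs : ∫ k : ℕ, ((k : ℝ) - m) * Real.exp (s * k) ∂μ = 0)
    (ht : ∫ k : ℕ, ((k : ℝ) - m) * Real.exp (t * k) ∂μ = 0) : False := by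
  set φ : ℕ → ℝ := fun k => ((k : ℝ) - m) * Real.exp (t * k) -
    Real.exp ((t - s) * m) * (((k : ℝ) - m) * Real.exp (s * k)) with hφ
  have hφ' : ∀ k : ℕ, φ k = Real.exp (s * k) *
      (((k : ℝ) - m) * (Real.exp ((t - s) * k) - Real.exp ((t - s) * m))) := by
    intro k
    have : Real.exp (t * k) = Real.exp (s * k) * Real.exp ((t - s) * k) := by
      rw [← Real.exp_add]; ring_nf
    simp only [hφ, this]; ring
  have iφ : Integrable φ μ := it.sub (is.const_mul _)
  have h0 : ∫ k, φ k ∂μ = 0 := by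
    simp only [hφ]
    rw [integral_sub it (is.const_mul _), integral_const_mul, hs, ht]; simp
  have hts : 0 < t - s := by linarith
  have hnn : 0 ≤ φ := by
    intro k
    rw [hφ']
    refine mul_nonneg (Real.exp_pos _).le ?_
    rcases le_total (k : ℝ) m with h | h
    · refine mul_nonneg_of_nonpos_of_nonpos (by linarith) ?_
      have := Real.exp_le_exp.2 (mul_le_mul_of_nonneg_left h hts.le)
      linarith
    · refine mul_nonneg (by linarith) ?_
      have := Real.exp_le_exp.2 (mul_le_mul_of_nonneg_left h hts.le)
      linarith
  rw [integral_eq_zero_iff_of_nonneg hnn iφ] at h0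
  refine hnc m ?_
  filter_upwards [h0] with k hk
  rw [hφ'] at hk
  simp only [Pi.zero_apply, mul_eq_zero, (Real.exp_pos _).ne', false_or] at hk
  rcases hk with hk | hk
  · linarith
  · have := Real.exp_injective (sub_eq_zero.1 hk)
    exact mul_left_cancel₀ hts.ne' this

lemma aux_tilt_mean (μ : Measure ℕ) [IsProbabilityMeasure μ] (s m : ℝ) (hm : m ≠ 0)
    (h : (∫ k : ℕ, (k : ℝ) ∂(μ.tilted fun k : ℕ => s * (k : ℝ))) = m) :
    Integrable (fun k : ℕ => ((k : ℝ) - m) * Real.exp (s * k)) μ ∧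
    ∫ k : ℕ, ((k : ℝ) - m) * Real.exp (s * k) ∂μ = 0 := by
  have h1 : Integrable (fun k : ℕ => Real.exp (s * k)) μ := by
    by_contra hc
    rw [tilted_of_not_integrable hc] at h
    simp at h; exact hm h.symm
  have h2 : Integrable (fun k : ℕ => (k : ℝ)) (μ.tilted fun k : ℕ => s * (k : ℝ)) := by
    by_contra hc
    rw [integral_undef hc] at h
    exact hm h.symm
  rw [integrable_tilted_iff h1] at h2
  have hZ : 0 < ∫ k : ℕ, Real.exp (s * k) ∂μ := integral_exp_pos h1
  have h3 : Integrable (fun k : ℕ => (k : ℝ) * Real.exp (s * k)) μ := by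
    simpa [mul_comm] using h2
  have h4 : ∫ k : ℕ, (k : ℝ) * Real.exp (s * k) ∂μ = m * ∫ k : ℕ, Real.exp (s * k) ∂μ := by
    rw [integral_tilted] at h
    rw [← h, ← integral_mul_const]
    congr 1; ext k; simp only [smul_eq_mul]; field_simp
  simp only [sub_mul]
  refine ⟨h3.sub (h1.const_mul m), ?_⟩
  rw [integral_sub h3 (h1.const_mul m), integral_const_mul, h4, sub_self]

lemma aux_nu (μ : Measure ℕ) [IsProbabilityMeasure μ] (lam : ℝ → ℝ) (ℓ : ℕ) (z : ℝ)
    (hi : Integrable (fun k : ℕ => Real.exp (lam z * k)) μ) :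
    nuTilt μ lam ℓ z = (Measure.pi fun _ : Fin ℓ => μ).tilted
      (fun ω => lam z * (∑ i, (ω i : ℝ))) := by
  have hexp : ∀ ω : Fin ℓ → ℕ, Real.exp (lam z * (∑ i, (ω i : ℝ))) = ∏ i, Real.exp (lam z * (ω i : ℝ)) := by
    intro ω; rw [Finset.mul_sum, Real.exp_sum]
  unfold nuTilt
  refine Measure.ext_of_singleton fun ω => ?_
  have : IsProbabilityMeasure (μ.tilted fun k : ℕ => lam z * (k : ℝ)) := isProbabilityMeasure_tilted hi
  rw [Measure.pi_singleton, tilted_apply]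
  simp only [hexp]
  rw [integral_fintype_prod_eq_prod (fun _ k => Real.exp (lam z * (k : ℕ)))]
  simp only [tilted_apply, lintegral_singleton, Measure.pi_singleton]
  rw [Finset.prod_mul_distrib, ← Finset.prod_div_distrib, ENNReal.ofReal_prod_of_nonneg]
  intro i _
  exact div_nonneg (Real.exp_pos _).le (integral_nonneg fun _ => (Real.exp_pos _).le)

lemma aux_moment {Ω : Type*} [MeasurableSpace Ω] (P : Measure Ω) 
    (S h : Ω → ℝ) (hh : Measurable h) (M : ℝ) (hb : ∀ ω, |h ω| ≤ M)
    (t : ℝ) (ht : t ∈ interior (integrableExpSet S P)) (n : ℕ) :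
    HasDerivAt (fun t => ∫ ω, h ω * (S ω ^ n * Real.exp (t * S ω)) ∂P)
      (∫ ω, h ω * (S ω ^ (n + 1) * Real.exp (t * S ω)) ∂P) t := by
  have hnn : ∀ ω, 0 ≤ h ω + M := fun ω => by have := abs_le.1 (hb ω); linarith
  set Q := P.withDensity (fun ω => ENNReal.ofReal (h ω + M)) with hQ
  have hm : Measurable (fun ω => ENNReal.ofReal (h ω + M)) := by fun_prop
  have hfin : ∀ᵐ ω ∂P, ENNReal.ofReal (h ω + M) < ⊤ := by simp
  have hint : ∀ f : Ω → ℝ, ∫ ω, f ω ∂Q = ∫ ω, (h ω + M) * f ω ∂P := by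
    intro f
    rw [hQ, integral_withDensity_eq_integral_toReal_smul hm hfin]
    simp [hnn]
  have hbdd : ∀ f : Ω → ℝ, Integrable f P → Integrable (fun ω => h ω * f ω) P := by
    intro f hf
    exact hf.bdd_mul hh.aestronglyMeasurable (Eventually.of_forall fun ω => by simpa using hb ω)
  have hsub : integrableExpSet S P ⊆ integrableExpSet S Q := by
    intro t ht
    simp only [integrableExpSet, Set.mem_ofPred_eq] at ht ⊢
    rw [hQ, integrable_withDensity_iff_integrable_smul' hm hfin]
    have := (hbdd _ ht).add (ht.const_mul M)
    refine this.congr (Eventually.of_forall fun ω => ?_)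
    simp [hnn, add_mul]
  have key : ∀ n, ∀ t ∈ interior (integrableExpSet S P),
      ∫ ω, h ω * (S ω ^ n * Real.exp (t * S ω)) ∂P =
       ∫ ω, (S ω ^ n * Real.exp (t * S ω)) ∂Q - M * ∫ ω, (S ω ^ n * Real.exp (t * S ω)) ∂P := by
    intro n t ht
    have hi : Integrable (fun ω => S ω ^ n * Real.exp (t * S ω)) P :=
      integrable_pow_mul_exp_of_mem_interior_integrableExpSet ht n
    rw [hint, ← integral_const_mul, ← integral_sub]
    · congr 1; ext ω; ring
    · simp only [add_mul]; exact (hbdd _ hi).add (hi.const_mul M)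
    · exact hi.const_mul M
  rw [key _ _ ht]
  have h1 := hasDerivAt_integral_pow_mul_exp_real (interior_mono hsub ht) n
  have h2 := (hasDerivAt_integral_pow_mul_exp_real ht n).const_mul M
  refine (h1.sub h2).congr_of_eventuallyEq ?_
  filter_upwards [isOpen_interior.mem_nhds ht] with s hs
  simpa using key n s hs

lemma aux_calc (p q : ℕ → ℝ → ℝ) (U : Set ℝ)
    (hp : ∀ n, ∀ t ∈ U, HasDerivAt (p n) (p (n + 1) t - p n t * q 1 t) t)
    (hq : ∀ n, ∀ t ∈ U, HasDerivAt (q n) (q (n + 1) t - q n t * q 1 t) t)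
    (lam : ℝ → ℝ) (ρ δ : ℝ) 
    (hl : ∀ y, |y| < δ → ContDiffAt ℝ 4 lam (ρ + y)) (hU : ∀ y, |y| < δ → lam (ρ + y) ∈ U)
    (g : ℝ → ℝ) (hg : ∀ y, |y| < δ → g y = p 0 (lam (ρ + y))) (y : ℝ) (hy : |y| < δ) :
    DifferentiableAt ℝ g y ∧ DifferentiableAt ℝ (deriv g) y ∧ DifferentiableAt ℝ (deriv (deriv g)) y ∧
    ∃ t, t = lam (ρ + y) ∧ deriv (deriv (deriv g)) y =
      deriv (deriv (deriv lam)) (ρ + y) * (p 1 t - p 0 t * q 1 t) +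
      3 * deriv lam (ρ + y) * deriv (deriv lam) (ρ + y) *
       (p 2 t - 2 * p 1 t * q 1 t - p 0 t * q 2 t + 2 * p 0 t * q 1 t ^ 2) +
      deriv lam (ρ + y) ^ 3 * (p 3 t - 3 * p 2 t * q 1 t - 3 * p 1 t * q 2 t + 6 * p 1 t * q 1 t ^ 2
        - p 0 t * q 3 t + 6 * p 0 t * q 1 t * q 2 t - 6 * p 0 t * q 1 t ^ 3) := by
  set G1 : ℝ → ℝ := fun t => p 1 t - p 0 t * q 1 t with hG1
  set G2 : ℝ → ℝ := fun t => p 2 t - 2 * p 1 t * q 1 t - p 0 t * q 2 t + 2 * p 0 t * q 1 t ^ 2 with hG2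
  set G3 : ℝ → ℝ := fun t => p 3 t - 3 * p 2 t * q 1 t - 3 * p 1 t * q 2 t + 6 * p 1 t * q 1 t ^ 2
        - p 0 t * q 3 t + 6 * p 0 t * q 1 t * q 2 t - 6 * p 0 t * q 1 t ^ 3 with hG3
  have d1 : ∀ t ∈ U, HasDerivAt G1 (G2 t) t := by
    intro t ht
    refine ((hp 1 t ht).sub ((hp 0 t ht).mul (hq 1 t ht))).congr_deriv ?_
    simp only [G2]; ring
  have d2 : ∀ t ∈ U, HasDerivAt G2 (G3 t) t := by
    intro t ht
    refine ((((hp 2 t ht).sub (((hp 1 t ht).const_mul 2).mul (hq 1 t ht))).sub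
      ((hp 0 t ht).mul (hq 2 t ht))).add (((hp 0 t ht).const_mul 2).mul ((hq 1 t ht).pow 2))).congr_deriv ?_
    simp only [G3, Pi.pow_apply]; push_cast; ring
  have hS : IsOpen {y : ℝ | |y| < δ} := isOpen_lt (by fun_prop) (by fun_prop)
  have l0 : ∀ y, |y| < δ → HasDerivAt (fun y => lam (ρ + y)) (deriv lam (ρ + y)) y := by
    intro y hy
    have := ((hl y hy).differentiableAt (by norm_num)).hasDerivAt
    exact this.comp_const_add ρ y
  have c1 : ∀ y, |y| < δ → ContDiffAt ℝ 3 (deriv lam) (ρ + y) := by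
    intro y hy
    exact (hl y hy).derivWithin (m := 3) (by norm_num)
  have c2 : ∀ y, |y| < δ → ContDiffAt ℝ 2 (deriv (deriv lam)) (ρ + y) := by
    intro y hy
    exact (c1 y hy).derivWithin (m := 2) (by norm_num)
  have l1 : ∀ y, |y| < δ → HasDerivAt (fun y => deriv lam (ρ + y)) (deriv (deriv lam) (ρ + y)) y := by
    intro y hy
    have := ((c1 y hy).differentiableAt (by norm_num)).hasDerivAt
    exact this.comp_const_add ρ y
  have l2 : ∀ y, |y| < δ → HasDerivAt (fun y => deriv (deriv lam) (ρ + y)) (deriv (deriv (deriv lam)) (ρ + y)) y := by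
    intro y hy
    have := ((c2 y hy).differentiableAt (by norm_num)).hasDerivAt
    exact this.comp_const_add ρ y
  have e1 : ∀ y, |y| < δ → HasDerivAt g (G1 (lam (ρ + y)) * deriv lam (ρ + y)) y := by
    intro y hy
    have h1 := (hp 0 _ (hU y hy)).comp y (l0 y hy)
    refine h1.congr_of_eventuallyEq ?_
    filter_upwards [hS.mem_nhds hy] with x hx
    exact hg x hx
  have e2 : ∀ y, |y| < δ → HasDerivAt (deriv g) (G2 (lam (ρ + y)) * deriv lam (ρ + y) * deriv lam (ρ + y)
      + G1 (lam (ρ + y)) * deriv (deriv lam) (ρ + y)) y := by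
    intro y hy
    have h1 := ((d1 _ (hU y hy)).comp y (l0 y hy)).mul (l1 y hy)
    refine h1.congr_of_eventuallyEq ?_
    filter_upwards [hS.mem_nhds hy] with x hx
    exact (e1 x hx).deriv
  have e3 := ((((d2 _ (hU y hy)).comp y (l0 y hy)).mul (l0 y hy |> fun _ => l1 y hy)).mul (l1 y hy)).add
    (((d1 _ (hU y hy)).comp y (l0 y hy)).mul (l2 y hy))
  have e3' := e3.congr_of_eventuallyEq (f₁ := deriv (deriv g)) (by
    filter_upwards [hS.mem_nhds hy] with x hx
    exact (e2 x hx).deriv)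
  refine ⟨(e1 y hy).differentiableAt, (e2 y hy).differentiableAt, e3'.differentiableAt, _, rfl, ?_⟩
  rw [e3'.deriv]
  simp only [Function.comp, Pi.mul_apply]
  simp only [hG1, hG2, hG3]
  ring

lemma aux_expand {Ω : Type*} [MeasurableSpace Ω] (N : Measure Ω) (S h : Ω → ℝ) (c d : ℝ) (n : ℕ)
    (hS : ∀ n, Integrable (fun ω => S ω ^ n) N)
    (hhS : ∀ n, Integrable (fun ω => h ω * S ω ^ n) N) :
    ∫ ω, (h ω - c) * (S ω - d) ^ n ∂N =
      ∑ m ∈ Finset.range (n + 1), (∫ ω, h ω * S ω ^ m ∂N - c * ∫ ω, S ω ^ m ∂N) *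
        ((-d) ^ (n - m) * (n.choose m)) := by
  have : ∀ ω, (h ω - c) * (S ω - d) ^ n = ∑ m ∈ Finset.range (n + 1),
      (h ω * S ω ^ m - c * S ω ^ m) * ((-d) ^ (n - m) * (n.choose m)) := by
    intro ω
    rw [sub_eq_add_neg (S ω) d, add_pow, Finset.mul_sum]
    refine Finset.sum_congr rfl fun m _ => ?_
    ring
  simp only [this]
  rw [integral_finsetSum]
  · refine Finset.sum_congr rfl fun m _ => ?_
    rw [integral_mul_const, integral_sub (hhS m) ((hS m).const_mul c), integral_const_mul]
  · intro m _
    exact ((hhS m).sub ((hS m).const_mul c)).mul_const _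

lemma aux_inverse (μ : Measure ℕ) [IsProbabilityMeasure μ]
    (ρ σ2 : ℝ) (hmean : ∫ k : ℕ, (k : ℝ) ∂μ = ρ)
    (hvar : ∫ k : ℕ, ((k : ℝ) - ρ) ^ 2 ∂μ = σ2) (hσ2 : 0 < σ2)
    (lamstar : ℝ) (hlamstar : 0 < lamstar)
    (hexp : ∀ t : ℝ, |t| ≤ lamstar → Integrable (fun k : ℕ => Real.exp (t * k)) μ)
    (lam : ℝ → ℝ) (δ₀ : ℝ) (hδ₀ : 0 < δ₀)
    (hlam : ∀ z : ℝ, |z - ρ| ≤ δ₀ →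
      (∫ k : ℕ, (k : ℝ) ∂(μ.tilted fun k : ℕ => lam z * (k : ℝ))) = z) :
    ∀ᶠ z in 𝓝 ρ, ContDiffAt ℝ 4 lam z ∧ |lam z| < lamstar := by
  set X : ℕ → ℝ := fun k => (k : ℝ) with hX
  have hsub : Set.Ioo (-lamstar) lamstar ⊆ interior (integrableExpSet X μ) := by
    refine interior_maximal ?_ isOpen_Ioo
    intro t ht
    exact hexp t (abs_le.2 ⟨ht.1.le, ht.2.le⟩)
  have h0 : (0 : ℝ) ∈ interior (integrableExpSet X μ) := hsub ⟨by linarith, hlamstar⟩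
  have hnc : ∀ m : ℝ, ¬ ∀ᵐ k : ℕ ∂μ, (k : ℝ) = m := by
    intro m hm
    have e1 : ρ = m := by
      rw [← hmean, integral_congr_ae (g := fun _ => m) hm]; simp
    have : ∫ k : ℕ, ((k : ℝ) - ρ) ^ 2 ∂μ = 0 := by
      rw [integral_congr_ae (g := fun _ => 0)]
      · simp
      · filter_upwards [hm] with k hk
        rw [hk, e1]; simp
    linarith
  have hXi : Integrable X μ := by
    simpa using integrable_pow_mul_exp_of_mem_interior_integrableExpSet h0 1
  have hρ : 0 < ρ := by
    have hnn : 0 ≤ X := fun k => Nat.cast_nonneg k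
    rcases (integral_nonneg (μ := μ) hnn).eq_or_lt with h | h
    · exfalso
      refine hnc 0 ?_
      exact (integral_eq_zero_iff_of_nonneg hnn hXi).1 h.symm
    · rw [← hmean]; exact h
  set f := deriv (cgf X μ) with hf
  have hfa : AnalyticAt ℝ f 0 := (analyticAt_cgf h0).deriv
  have hf0 : f 0 = ρ := by
    rw [hf, deriv_cgf_zero h0]; simpa [hX] using hmean
  have hf1 : deriv f 0 = σ2 := by
    have := iteratedDeriv_two_cgf_eq_integral h0
    rw [iteratedDeriv_succ, iteratedDeriv_one] at this
    rw [hf, this, ← hf, hf0]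
    simp [hX, hvar]
  have hfd : HasFDerivAt f ((ContinuousLinearEquiv.unitsEquivAut ℝ (Units.mk0 σ2 hσ2.ne') : ℝ ≃L[ℝ] ℝ) : ℝ →L[ℝ] ℝ) 0 := by
    have := hfa.differentiableAt.hasDerivAt
    rw [hf1] at this
    exact this.hasFDerivAt_equiv hσ2.ne'
  have hfc : ContDiffAt ℝ 4 f 0 := hfa.contDiffAt
  have h4 : (4 : WithTop ℕ∞) ≠ 0 := by norm_num
  set L := hfc.localInverse hfd h4 with hL
  have hLc : ContDiffAt ℝ 4 L ρ := by
    have := hfc.to_localInverse hfd h4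
    rwa [hf0] at this
  have hL0 : L ρ = 0 := by
    have := hfc.localInverse_apply_image hfd h4
    rwa [hf0] at this
  have hLr : ∀ᶠ z in 𝓝 ρ, f (L z) = z := by
    have := (hfc.hasStrictFDerivAt' hfd h4).eventually_right_inverse
    rw [hf0] at this
    exact this
  have hLU : ∀ᶠ z in 𝓝 ρ, L z ∈ Set.Ioo (-lamstar) lamstar := by
    refine hLc.continuousAt.eventually_mem ?_
    rw [hL0]; exact Ioo_mem_nhds (by linarith) hlamstar
  have hz : ∀ᶠ z in 𝓝 ρ, |z - ρ| ≤ δ₀ := by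
    filter_upwards [Metric.ball_mem_nhds ρ hδ₀] with z hz
    rw [Metric.mem_ball, Real.dist_eq] at hz; exact hz.le
  have heq : ∀ᶠ z in 𝓝 ρ, lam z = L z := by
    filter_upwards [hLr, hLU, hz, eventually_gt_nhds hρ] with z h1 h2 h3 h4
    have t1 := aux_tilt_mean μ _ z h4.ne' (hlam z h3)
    have t2 := aux_tilt_mean μ (L z) z h4.ne' (by
      have := integral_tilted_mul_self (hsub h2)
      rw [← hf, h1] at this
      exact this)
    rcases lt_trichotomy (lam z) (L z) with h | h | h
    · exact (aux_inj_lt μ hnc _ _ z h t1.1 t2.1 t1.2 t2.2).elim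
    · exact h
    · exact (aux_inj_lt μ hnc _ _ z h t2.1 t1.1 t2.2 t1.2).elim
  filter_upwards [heq.eventually_nhds, hLU, hLc.eventually (by norm_num)] with z h1 h2 h3
  refine ⟨h3.congr_of_eventuallyEq h1, ?_⟩
  rw [h1.self_of_nhds]
  exact abs_lt.2 h2

/-- Third derivative of the tilted mean: for bounded `h`, the function
`g(y) = E_{ν_{ρ+y}}[h]` is three times differentiable near `0`, with
`g'''(y) = λ''' E[h̄Σ] + 3λ'λ'' E[h̄Σ²] + (λ')³ E[h̄Σ³] − 3(λ')³ E[h̄Σ] E[Σ²]`,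
where `λ', λ'', λ'''` are evaluated at `ρ+y`, `h̄ = h − E_{ν_{ρ+y}}[h]`,
`Σ = ∑_{x=1}^ℓ (X_x − ρ − y)`, and all expectations are under `ν_{ρ+y}`. -/
theorem stmt_13 (μ : Measure ℕ) [IsProbabilityMeasure μ]
    (ρ σ2 : ℝ) (hmean : ∫ k : ℕ, (k : ℝ) ∂μ = ρ)
    (hvar : ∫ k : ℕ, ((k : ℝ) - ρ) ^ 2 ∂μ = σ2) (hσ2 : 0 < σ2)
    (lamstar : ℝ) (hlamstar : 0 < lamstar)
    (hexp : ∀ t : ℝ, |t| ≤ lamstar → Integrable (fun k : ℕ => Real.exp (t * k)) μ)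
    (ℓ : ℕ) (hℓ : 1 ≤ ℓ)
    (lam : ℝ → ℝ) (δ₀ : ℝ) (hδ₀ : 0 < δ₀)
    (hlam : ∀ z : ℝ, |z - ρ| ≤ δ₀ →
      (∫ k : ℕ, (k : ℝ) ∂(μ.tilted fun k : ℕ => lam z * (k : ℝ))) = z)
    (h : (Fin ℓ → ℕ) → ℝ) (M : ℝ) (hb : ∀ ω, |h ω| ≤ M) :
    ∃ δ : ℝ, 0 < δ ∧ ∀ y : ℝ, |y| < δ →
      DifferentiableAt ℝ (gFun μ lam ℓ ρ h) y ∧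
      DifferentiableAt ℝ (deriv (gFun μ lam ℓ ρ h)) y ∧
      DifferentiableAt ℝ (deriv (deriv (gFun μ lam ℓ ρ h))) y ∧
      deriv (deriv (deriv (gFun μ lam ℓ ρ h))) y =
        deriv (deriv (deriv lam)) (ρ + y) *
            (∫ ω, (h ω - gFun μ lam ℓ ρ h y) * centSum ℓ (ρ + y) ω
              ∂(nuTilt μ lam ℓ (ρ + y))) +
          3 * deriv lam (ρ + y) * deriv (deriv lam) (ρ + y) *
            (∫ ω, (h ω - gFun μ lam ℓ ρ h y) * centSum ℓ (ρ + y) ω ^ 2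
              ∂(nuTilt μ lam ℓ (ρ + y))) +
          deriv lam (ρ + y) ^ 3 *
            (∫ ω, (h ω - gFun μ lam ℓ ρ h y) * centSum ℓ (ρ + y) ω ^ 3
              ∂(nuTilt μ lam ℓ (ρ + y))) -
          3 * deriv lam (ρ + y) ^ 3 *
            (∫ ω, (h ω - gFun μ lam ℓ ρ h y) * centSum ℓ (ρ + y) ω
              ∂(nuTilt μ lam ℓ (ρ + y))) *
            (∫ ω, centSum ℓ (ρ + y) ω ^ 2 ∂(nuTilt μ lam ℓ (ρ + y))) := by
  obtain ⟨δ₁, hδ₁, hball⟩ := Metric.eventually_nhds_iff.1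
    (aux_inverse μ ρ σ2 hmean hvar hσ2 lamstar hlamstar hexp lam δ₀ hδ₀ hlam)
  set P : Measure (Fin ℓ → ℕ) := Measure.pi fun _ : Fin ℓ => μ with hP
  set S : (Fin ℓ → ℕ) → ℝ := fun ω => ∑ i, (ω i : ℝ) with hS
  have hsub : Set.Ioo (-lamstar) lamstar ⊆ interior (integrableExpSet S P) := by
    refine interior_maximal ?_ isOpen_Ioo
    intro t ht
    have hi := hexp t (abs_le.2 ⟨ht.1.le, ht.2.le⟩)
    have := Integrable.fintype_prod (μ := fun _ : Fin ℓ => μ)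
      (f := fun _ (k : ℕ) => Real.exp (t * k)) (fun _ => hi)
    refine this.congr (Eventually.of_forall fun ω => ?_)
    simp only [hS]
    rw [Finset.mul_sum, Real.exp_sum]
  have hE : ∀ t ∈ Set.Ioo (-lamstar) lamstar, Integrable (fun ω => Real.exp (t * S ω)) P := by
    intro t ht
    have : t ∈ integrableExpSet S P := interior_subset (hsub ht)
    exact this
  have hPp : IsProbabilityMeasure P := by rw [hP]; infer_instance
  have hh : Measurable h := measurable_of_countable h
  set a : ℕ → ℝ → ℝ := fun n t => ∫ ω, h ω * (S ω ^ n * Real.exp (t * S ω)) ∂P with ha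
  set b : ℕ → ℝ → ℝ := fun n t => ∫ ω, 1 * (S ω ^ n * Real.exp (t * S ω)) ∂P with hbdef
  have hda : ∀ n, ∀ t ∈ Set.Ioo (-lamstar) lamstar, HasDerivAt (a n) (a (n + 1) t) t :=
    fun n t ht => aux_moment P S h hh M hb t (hsub ht) n
  have hdb : ∀ n, ∀ t ∈ Set.Ioo (-lamstar) lamstar, HasDerivAt (b n) (b (n + 1) t) t :=
    fun n t ht => aux_moment P S (fun _ => 1) measurable_const 1 (by simp) t (hsub ht) n
  have hb0 : ∀ t, b 0 t = ∫ ω, Real.exp (t * S ω) ∂P := by intro t; simp [hbdef]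
  have hbpos : ∀ t ∈ Set.Ioo (-lamstar) lamstar, 0 < b 0 t := by
    intro t ht
    rw [hb0]
    exact integral_exp_pos (hE t ht)
  set p : ℕ → ℝ → ℝ := fun n t => a n t / b 0 t with hp
  set q : ℕ → ℝ → ℝ := fun n t => b n t / b 0 t with hq
  have hdp : ∀ n, ∀ t ∈ Set.Ioo (-lamstar) lamstar,
      HasDerivAt (p n) (p (n + 1) t - p n t * q 1 t) t := by
    intro n t ht
    have h0 := (hbpos t ht).ne'
    refine ((hda n t ht).div (hdb 0 t ht) h0).congr_deriv ?_
    simp only [hp, hq]; field_simp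
  have hdq : ∀ n, ∀ t ∈ Set.Ioo (-lamstar) lamstar,
      HasDerivAt (q n) (q (n + 1) t - q n t * q 1 t) t := by
    intro n t ht
    have h0 := (hbpos t ht).ne'
    refine ((hdb n t ht).div (hdb 0 t ht) h0).congr_deriv ?_
    simp only [hq]; field_simp
  have hloc : ∀ y, |y| < min δ₁ δ₀ → ContDiffAt ℝ 4 lam (ρ + y) ∧ |lam (ρ + y)| < lamstar := by
    intro y hy
    refine hball ?_
    rw [Real.dist_eq]; simpa using hy.trans_le (min_le_left _ _)
  have hU : ∀ y, |y| < min δ₁ δ₀ → lam (ρ + y) ∈ Set.Ioo (-lamstar) lamstar :=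
    fun y hy => abs_lt.1 (hloc y hy).2
  have hnu : ∀ y, |y| < min δ₁ δ₀ →
      nuTilt μ lam ℓ (ρ + y) = P.tilted (fun ω => lam (ρ + y) * S ω) := by
    intro y hy
    exact aux_nu μ lam ℓ (ρ + y) (hexp _ (hloc y hy).2.le)
  have hIh : ∀ y, ∀ f : (Fin ℓ → ℕ) → ℝ, ∀ n,
      ∫ ω, f ω * S ω ^ n ∂(P.tilted (fun ω => lam (ρ + y) * S ω)) =
      (∫ ω, f ω * (S ω ^ n * Real.exp (lam (ρ + y) * S ω)) ∂P) / b 0 (lam (ρ + y)) := by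
    intro y f n
    rw [integral_tilted, ← hb0, ← integral_div]
    congr 1; ext ω; simp only [smul_eq_mul]; ring
  refine ⟨min δ₁ δ₀, lt_min hδ₁ hδ₀, fun y hy => ?_⟩
  have hgp : ∀ y, |y| < min δ₁ δ₀ → gFun μ lam ℓ ρ h y = p 0 (lam (ρ + y)) := by
    intro y hy
    have := hIh y h 0
    simp only [pow_zero, mul_one] at this
    rw [gFun, hnu y hy, this]
    simp [hp, ha]
  obtain ⟨r1, r2, r3, t, ht, r4⟩ := aux_calc p q _ hdp hdq lam ρ (min δ₁ δ₀)
    (fun y hy => (hloc y hy).1) hU (gFun μ lam ℓ ρ h) hgp y hy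
  refine ⟨r1, r2, r3, ?_⟩
  rw [r4, hgp y hy, hnu y hy]
  have htU := hU y hy
  rw [← ht] at htU ⊢
  have hIp : ∀ n, ∫ ω, h ω * S ω ^ n ∂(P.tilted (fun ω => t * S ω)) = p n t := by
    intro n; rw [ht]; exact hIh y h n
  have hIq : ∀ n, ∫ ω, S ω ^ n ∂(P.tilted (fun ω => t * S ω)) = q n t := by
    intro n
    have := hIh y (fun _ => 1) n
    rw [ht]
    simpa only [one_mul, hq, hbdef] using this
  have hiS : ∀ n, Integrable (fun ω => S ω ^ n) (P.tilted (fun ω => t * S ω)) := by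
    intro n
    rw [integrable_tilted_iff (hE t htU)]
    have := integrable_pow_mul_exp_of_mem_interior_integrableExpSet (hsub htU) n
    simpa only [smul_eq_mul, mul_comm] using this
  have hihS : ∀ n, Integrable (fun ω => h ω * S ω ^ n) (P.tilted (fun ω => t * S ω)) := by
    intro n
    exact (hiS n).bdd_mul hh.aestronglyMeasurable
      (Eventually.of_forall fun ω => by simpa using hb ω)
  have hprob : IsProbabilityMeasure (P.tilted (fun ω => t * S ω)) :=
    isProbabilityMeasure_tilted (hE t htU)
  have hprob1 : IsProbabilityMeasure (μ.tilted fun k : ℕ => t * (k : ℝ)) :=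
    isProbabilityMeasure_tilted (hexp t (abs_le.2 ⟨htU.1.le, htU.2.le⟩))
  have hq0 : q 0 t = 1 := div_self (hbpos t htU).ne'
  have hmt := hlam (ρ + y) (by simpa using (hy.trans_le (min_le_right _ _)).le)
  have hq1 : q 1 t = ℓ * (ρ + y) := by
    have hpi : P.tilted (fun ω => t * S ω) =
        Measure.pi (fun _ : Fin ℓ => μ.tilted fun k : ℕ => t * (k : ℝ)) := by
      rw [ht, ← hnu y hy]; rfl
    rw [← hIq 1, hpi]
    have hev : ∀ i : Fin ℓ, MeasurePreserving (Function.eval i)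
        (Measure.pi (fun _ : Fin ℓ => μ.tilted fun k : ℕ => t * (k : ℝ)))
        (μ.tilted fun k : ℕ => t * (k : ℝ)) := fun i => measurePreserving_eval _ i
    have hi1 : Integrable (fun k : ℕ => (k : ℝ)) (μ.tilted fun k : ℕ => t * (k : ℝ)) := by
      have hsub1 : Set.Ioo (-lamstar) lamstar ⊆
          interior (integrableExpSet (fun k : ℕ => (k : ℝ)) μ) :=
        interior_maximal (fun s hs => hexp s (abs_le.2 ⟨hs.1.le, hs.2.le⟩)) isOpen_Ioo
      exact memLp_one_iff_integrable.1 (memLp_tilted_mul (hsub1 htU) 1)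
    simp only [hS, pow_one]
    rw [integral_finsetSum]
    · have : ∀ i : Fin ℓ, ∫ ω : Fin ℓ → ℕ, (ω i : ℝ)
          ∂(Measure.pi (fun _ : Fin ℓ => μ.tilted fun k : ℕ => t * (k : ℝ))) = ρ + y := by
        intro i
        have hmt' : ∫ k : ℕ, (k : ℝ) ∂(μ.tilted fun k : ℕ => t * (k : ℝ)) = ρ + y := by
          rw [ht]; exact hmt
        have h5 := integral_map
          (μ := Measure.pi (fun _ : Fin ℓ => μ.tilted fun k : ℕ => t * (k : ℝ)))
          (φ := Function.eval i) (hev i).measurable.aemeasurable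
          (f := fun k : ℕ => (k : ℝ)) (measurable_of_countable _).aestronglyMeasurable
        rw [(hev i).map_eq] at h5
        exact h5.symm.trans hmt'
      simp [this, mul_add]
    · intro i _
      exact (hev i).integrable_comp_of_integrable hi1
  have hcs : ∀ ω, centSum ℓ (ρ + y) ω = S ω - q 1 t := by
    intro ω
    rw [hq1, centSum, Finset.sum_sub_distrib]
    simp [hS, mul_add]
  have x1 := aux_expand _ S h (p 0 t) (q 1 t) 1 hiS hihS
  have x2 := aux_expand _ S h (p 0 t) (q 1 t) 2 hiS hihS
  have x3 := aux_expand _ S h (p 0 t) (q 1 t) 3 hiS hihS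
  have x4 := aux_expand _ S (fun _ => 1) 0 (q 1 t) 2 hiS (by simpa using hiS)
  simp only [hIp, hIq, one_mul, sub_zero, zero_mul, Finset.sum_range_succ, Finset.sum_range_zero,
    hq0, pow_one] at x1 x2 x3 x4
  simp only [hcs]
  rw [x1, x2, x3, x4]
  norm_num [Nat.choose]
  ring
end
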